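/- Independence of the mollifier: Assume in addition that g is continuous, and let θ and θ̄ be two nonnegative smooth mollifiers. Suppose (X(ε,x))_{ε,x} and (X̄(ε,x))_{ε,x} are jointly measurable families on a common probability space whose combined finite-dimensional distributions are centered Gaussian, with E[X(ε,x) X(ε',y)] = ∫∫ θ_ε(u) θ_{ε'}(v) K(x−u, y−v) du dv, E[X̄(ε,x) X̄(ε',y)] = ∫∫ θ̄_ε(u) θ̄_{ε'}(v) K(x−u, y−v) du dv, and cross-covariance E[X(ε,x) X̄(ε',y)] = ∫∫ θ_ε(u) θ̄_{ε'}(v) K(x−u, y−v) du dv (i.e. both are mollifications of the same underlying log-correlated field). Let M_ε and M̄_ε be the associated approximate chaos measures built from X and X̄ respectively with the same γ ∈ (0, √d) and the same bounded measurable density f ≥ 0. Then for every compact A ⊂ ℝ^d, E[ (M_ε(A) − M̄_ε(A))² ] → 0 as ε → 0. -/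

import Mathlib

open MeasureTheory ProbabilityTheory Filter Topology
open scoped ENNReal NNReal

noncomputable section

variable {d : ℕ}

/-- The rescaled mollifier `θ_ε(x) = ε^{-d} θ(x/ε)`. -/
def mollifierScaled (θ : EuclideanSpace ℝ (Fin d) → ℝ) (ε : ℝ)
    (x : EuclideanSpace ℝ (Fin d)) : ℝ :=
  (ε ^ d)⁻¹ * θ (ε⁻¹ • x)

/-- A nonnegative smooth mollifier: `C^∞`, compactly supported, nonnegative, total integral 1. -/
def IsMollifier (θ : EuclideanSpace ℝ (Fin d) → ℝ) : Prop :=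
  ContDiff ℝ (⊤ : ℕ∞) θ ∧ HasCompactSupport θ ∧ (∀ x, 0 ≤ θ x) ∧ (∫ x, θ x) = 1

/-- The kernel of log-type associated to `g`: `K(x,y) = ln₊(1/|x-y|) + g(x,y)` where
`ln₊ u = max (ln u) 0`. -/
def logKernel (g : EuclideanSpace ℝ (Fin d) → EuclideanSpace ℝ (Fin d) → ℝ)
    (x y : EuclideanSpace ℝ (Fin d)) : ℝ :=
  max (Real.log (dist x y)⁻¹) 0 + g x y

/-- `g` is bounded and (jointly) measurable. -/
def IsBoundedMeasurable (g : EuclideanSpace ℝ (Fin d) → EuclideanSpace ℝ (Fin d) → ℝ) : Prop :=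
  Measurable (Function.uncurry g) ∧ ∃ C, ∀ x y, |g x y| ≤ C

/-- The mollified covariance `K_{ε,ε'}(x,y) = ∫∫ θ₁_ε(u) θ₂_{ε'}(v) K(x-u, y-v) du dv`. -/
def mollifiedCov (K : EuclideanSpace ℝ (Fin d) → EuclideanSpace ℝ (Fin d) → ℝ)
    (θ₁ θ₂ : EuclideanSpace ℝ (Fin d) → ℝ) (ε ε' : ℝ)
    (x y : EuclideanSpace ℝ (Fin d)) : ℝ :=
  ∫ u, ∫ v, mollifierScaled θ₁ ε u * mollifierScaled θ₂ ε' v * K (x - u) (y - v)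

/-- `X = (X(ε,x))` is a jointly measurable family whose finite-dimensional distributions are
centered Gaussian with covariance `E[X(ε,x) X(ε',y)] = Km ε ε' x y` (expressed by requiring
every finite real linear combination to have the appropriate centered Gaussian law). -/
def IsGaussianFamily {Ω : Type*} [MeasurableSpace Ω] (P : Measure Ω)
    (X : ℝ → EuclideanSpace ℝ (Fin d) → Ω → ℝ)
    (Km : ℝ → ℝ → EuclideanSpace ℝ (Fin d) → EuclideanSpace ℝ (Fin d) → ℝ) : Prop :=
  (Measurable fun p : ℝ × EuclideanSpace ℝ (Fin d) × Ω => X p.1 p.2.1 p.2.2) ∧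
  ∀ (n : ℕ) (ε : Fin n → ℝ) (x : Fin n → EuclideanSpace ℝ (Fin d)),
    (∀ i, ε i ∈ Set.Ioc (0 : ℝ) 1) → ∀ l : Fin n → ℝ, ∃ v : ℝ≥0,
      (v : ℝ) = ∑ i, ∑ j, l i * l j * Km (ε i) (ε j) (x i) (x j) ∧
      Measure.map (fun ω => ∑ i, l i * X (ε i) (x i) ω) P = gaussianReal 0 v

/-- The approximate Gaussian multiplicative chaos measure
`M_ε(A) = ∫_A exp(γ X(ε,x) - (γ²/2) Km ε ε x x) f(x) dx`. -/
def approxGMC {Ω : Type*} (γ : ℝ) (X : ℝ → EuclideanSpace ℝ (Fin d) → Ω → ℝ)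
    (Km : ℝ → ℝ → EuclideanSpace ℝ (Fin d) → EuclideanSpace ℝ (Fin d) → ℝ)
    (f : EuclideanSpace ℝ (Fin d) → ℝ) (ε : ℝ) (ω : Ω)
    (A : Set (EuclideanSpace ℝ (Fin d))) : ℝ :=
  ∫ x in A, Real.exp (γ * X ε x ω - γ ^ 2 / 2 * Km ε ε x x) * f x

/-- `M` is the Gaussian multiplicative chaos measure on `D`: a random Radon measure on `D`
such that `M_ε(A) → M(A)` in probability as `ε → 0` for every Borel `A` with compact closure
contained in `D`. -/
def IsGMCMeasure {Ω : Type*} [MeasurableSpace Ω] (P : Measure Ω) (γ : ℝ)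
    (X : ℝ → EuclideanSpace ℝ (Fin d) → Ω → ℝ)
    (Km : ℝ → ℝ → EuclideanSpace ℝ (Fin d) → EuclideanSpace ℝ (Fin d) → ℝ)
    (f : EuclideanSpace ℝ (Fin d) → ℝ) (D : Set (EuclideanSpace ℝ (Fin d)))
    (M : Ω → Measure (EuclideanSpace ℝ (Fin d))) : Prop :=
  (∀ A : Set (EuclideanSpace ℝ (Fin d)), MeasurableSet A → Measurable fun ω => M ω A) ∧
  (∀ ω, ∀ A : Set (EuclideanSpace ℝ (Fin d)), IsCompact (closure A) → closure A ⊆ D →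
    M ω A ≠ ⊤) ∧
  (∀ A : Set (EuclideanSpace ℝ (Fin d)), MeasurableSet A → IsCompact (closure A) →
    closure A ⊆ D →
    TendstoInMeasure P (fun ε ω => approxGMC γ X Km f ε ω A) (𝓝[Set.Ioc (0 : ℝ) 1] 0)
      fun ω => (M ω A).toReal)

section PosLog

open Real (posLog)

lemma measurable_posLog_norm_inv {E : Type*} [NormedAddCommGroup E] [MeasurableSpace E]
    [BorelSpace E] : Measurable fun x : E => Real.posLog ‖x‖⁻¹ :=
  Real.continuous_posLog.measurable.comp measurable_norm.inv

/-- Comparison of the logarithmic singularity before and after a translation at scale `ε`. -/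
lemma posLog_norm_inv_sub_smul_le {E : Type*} [NormedAddCommGroup E] [NormedSpace ℝ E]
    {ε R : ℝ} (hε : 0 < ε) {z w : E} (hz : z ≠ 0) (hw : ‖w‖ ≤ R) :
    posLog ‖z - ε • w‖⁻¹ ≤
      posLog ‖z‖⁻¹ + (Real.log 2 + posLog R) + posLog ‖ε⁻¹ • z - w‖⁻¹ := by
  have hR : 0 ≤ R := (norm_nonneg w).trans hw
  have h2 : 0 ≤ Real.log 2 := Real.log_nonneg (by norm_num)
  rcases eq_or_ne (z - ε • w) 0 with h0 | h0
  · rw [h0, norm_zero, inv_zero, Real.posLog_zero]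
    have := Real.posLog_nonneg (x := ‖z‖⁻¹)
    have := Real.posLog_nonneg (x := R)
    have := Real.posLog_nonneg (x := ‖ε⁻¹ • z - w‖⁻¹)
    linarith
  have ha : 0 < ‖z - ε • w‖ := norm_pos_iff.2 h0
  have hz' : 0 < ‖z‖ := norm_pos_iff.2 hz
  have hb : ‖ε⁻¹ • z - w‖ = ε⁻¹ * ‖z - ε • w‖ := by
    rw [← norm_smul_of_nonneg (inv_nonneg.2 hε.le), smul_sub, inv_smul_smul₀ hε.ne']
  have hzle : ‖z‖ ≤ ‖z - ε • w‖ + ε * R := by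
    calc ‖z‖ = ‖(z - ε • w) + ε • w‖ := by rw [sub_add_cancel]
      _ ≤ ‖z - ε • w‖ + ‖ε • w‖ := norm_add_le _ _
      _ ≤ _ := by rw [norm_smul_of_nonneg hε.le]; gcongr
  have hmul : ‖z - ε • w‖⁻¹ = ‖z‖⁻¹ * (‖z‖ * ‖z - ε • w‖⁻¹) := by
    rw [inv_mul_cancel_left₀ hz'.ne']
  have hle : ‖z‖ * ‖z - ε • w‖⁻¹ ≤ 1 + R * ‖ε⁻¹ • z - w‖⁻¹ := by
    rw [hb, mul_inv, inv_inv, ← div_eq_mul_inv, div_le_iff₀ ha]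
    calc ‖z‖ ≤ ‖z - ε • w‖ + ε * R := hzle
      _ = _ := by field_simp
  have h1 : posLog (‖z‖ * ‖z - ε • w‖⁻¹) ≤ posLog (1 + R * ‖ε⁻¹ • z - w‖⁻¹) :=
    Real.posLog_le_posLog (by positivity) hle
  have h3 := Real.posLog_add (x := 1) (y := R * ‖ε⁻¹ • z - w‖⁻¹)
  have h4 := Real.posLog_mul (x := R) (y := ‖ε⁻¹ • z - w‖⁻¹)
  have h5 := Real.posLog_mul (x := ‖z‖⁻¹) (y := ‖z‖ * ‖z - ε • w‖⁻¹)
  rw [Real.posLog_one] at h3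
  rw [hmul]
  linarith

lemma integrableOn_exp_mul_posLog_norm_inv {E : Type*} [NormedAddCommGroup E] [NormedSpace ℝ E]
    [FiniteDimensional ℝ E] [Nontrivial E] [MeasurableSpace E] [BorelSpace E]
    (μ : Measure E) [μ.IsAddHaarMeasure] {s : ℝ} (hs : s < Module.finrank ℝ E) (r : ℝ) :
    IntegrableOn (fun x : E => Real.exp (s * posLog ‖x‖⁻¹)) (Metric.ball 0 r) μ := by
  have hpos : 0 < Module.finrank ℝ E := Module.finrank_pos
  refine (integrableOn_fun_norm_addHaar μ
    (f := fun y : ℝ => Real.exp (s * posLog y⁻¹)) (r := r)).2 ?_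
  rcases le_or_gt r 0 with hr | hr
  · simp [Set.Ioo_eq_empty_of_le hr]
  have hint : IntegrableOn (fun y : ℝ => y ^ ((Module.finrank ℝ E - 1 : ℕ) : ℝ) +
      y ^ (((Module.finrank ℝ E - 1 : ℕ) : ℝ) - s)) (Set.Ioo 0 r) := by
    refine Integrable.add ?_ ?_
    · exact (intervalIntegral.integrableOn_Ioo_rpow_iff hr).2 (by
        have : (0 : ℝ) ≤ ((Module.finrank ℝ E - 1 : ℕ) : ℝ) := Nat.cast_nonneg _
        linarith)
    · exact (intervalIntegral.integrableOn_Ioo_rpow_iff hr).2 (by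
        rw [Nat.cast_sub hpos, Nat.cast_one]; linarith)
  refine Integrable.mono' hint ?_ ?_
  · refine Measurable.aestronglyMeasurable ?_
    have := Real.continuous_posLog.measurable
    fun_prop
  · filter_upwards [ae_restrict_mem measurableSet_Ioo] with y hy
    have hy0 : 0 < y := hy.1
    rw [smul_eq_mul, Real.norm_of_nonneg (by positivity), Real.rpow_sub hy0, Real.rpow_natCast]
    have hle : Real.exp (s * posLog y⁻¹) ≤ 1 + (y ^ s)⁻¹ := by
      have hys : 0 < y ^ s := Real.rpow_pos_of_pos hy0 s
      rcases max_choice 0 (Real.log y⁻¹) with h | h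
      · rw [Real.posLog_apply, h, mul_zero, Real.exp_zero]
        have := inv_pos.2 hys
        linarith
      · rw [Real.posLog_apply, h, mul_comm, ← Real.rpow_def_of_pos (inv_pos.2 hy0),
          Real.inv_rpow hy0.le]
        linarith
    calc _ ≤ y ^ (Module.finrank ℝ E - 1) * (1 + (y ^ s)⁻¹) := by gcongr
      _ = _ := by ring

lemma integrable_posLog_norm_inv {E : Type*} [NormedAddCommGroup E] [NormedSpace ℝ E]
    [FiniteDimensional ℝ E] [Nontrivial E] [MeasurableSpace E] [BorelSpace E]
    (μ : Measure E) [μ.IsAddHaarMeasure] :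
    Integrable (fun x : E => posLog ‖x‖⁻¹) μ := by
  have hpos : (1 : ℝ) ≤ Module.finrank ℝ E := by exact_mod_cast Module.finrank_pos (R := ℝ) (M := E)
  have h := integrableOn_exp_mul_posLog_norm_inv (E := E) μ (s := 1 / 2) (by linarith) 1
  rw [← integrable_indicator_iff measurableSet_ball] at h
  refine (h.const_mul 2).mono' measurable_posLog_norm_inv.aestronglyMeasurable ?_
  refine Eventually.of_forall fun x => ?_
  rw [Real.norm_of_nonneg Real.posLog_nonneg]
  by_cases hx : x ∈ Metric.ball (0 : E) 1
  · rw [Set.indicator_of_mem hx]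
    have := Real.add_one_le_exp (1 / 2 * posLog ‖x‖⁻¹)
    linarith
  · rw [Set.indicator_of_notMem hx, mul_zero, (Real.posLog_eq_zero_iff _).2]
    rw [abs_of_nonneg (by positivity)]
    exact inv_le_one_of_one_le₀ (by simpa using hx)

/-- The power singularity on the diagonal is integrable on bounded squares. -/
lemma integrable_exp_mul_posLog_norm_sub_inv {E : Type*} [NormedAddCommGroup E]
    [NormedSpace ℝ E] [FiniteDimensional ℝ E] [Nontrivial E] [MeasurableSpace E] [BorelSpace E]
    (μ : Measure E) [μ.IsAddHaarMeasure] {s : ℝ} (hs : s < Module.finrank ℝ E)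
    {A : Set E} (hA : Bornology.IsBounded A) (hAm : MeasurableSet A) :
    Integrable (fun p : E × E => Real.exp (s * posLog ‖p.1 - p.2‖⁻¹))
      ((μ.restrict A).prod (μ.restrict A)) := by
  obtain ⟨r, hr⟩ := hA.subset_ball 0
  have hF := (integrable_indicator_iff measurableSet_ball).2
    (integrableOn_exp_mul_posLog_norm_inv μ hs (r + r))
  have h1 : Integrable (A.indicator fun _ => (1 : ℝ)) μ :=
    (integrable_indicator_iff hAm).2 (integrableOn_const hA.measure_lt_top.ne)
  have h := h1.convolution_integrand (ContinuousLinearMap.mul ℝ ℝ) hF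
  rw [Measure.prod_restrict]
  have h' := h.integrableOn (s := A ×ˢ A)
  refine h'.congr ?_
  filter_upwards [ae_restrict_mem (hAm.prod hAm)] with p hp
  have hmem : p.1 - p.2 ∈ Metric.ball (0 : E) (r + r) := by
    have h1 := hr hp.1
    have h2 := hr hp.2
    rw [mem_ball_zero_iff] at *
    exact (norm_sub_le _ _).trans_lt (add_lt_add h1 h2)
  rw [Set.indicator_of_mem hp.2, Set.indicator_of_mem hmem]
  simp

end PosLog

section Mollification

variable {K : EuclideanSpace ℝ (Fin d) → EuclideanSpace ℝ (Fin d) → ℝ}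
  {g : EuclideanSpace ℝ (Fin d) → EuclideanSpace ℝ (Fin d) → ℝ}
  {θ θ₁ θ₂ : EuclideanSpace ℝ (Fin d) → ℝ}

/-- The measure with density `θ`. -/
def mollifierMeasure (θ : EuclideanSpace ℝ (Fin d) → ℝ) : Measure (EuclideanSpace ℝ (Fin d)) :=
  volume.withDensity fun x => ENNReal.ofReal (θ x)

lemma IsMollifier.measurable (hθ : IsMollifier θ) : Measurable θ :=
  hθ.1.continuous.measurable

lemma IsMollifier.integrable (hθ : IsMollifier θ) : Integrable θ :=
  hθ.1.continuous.integrable_of_hasCompactSupport hθ.2.1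

lemma IsMollifier.isProbabilityMeasure (hθ : IsMollifier θ) :
    IsProbabilityMeasure (mollifierMeasure θ) := by
  refine ⟨?_⟩
  rw [mollifierMeasure, withDensity_apply _ MeasurableSet.univ, Measure.restrict_univ,
    ← ofReal_integral_eq_lintegral_ofReal hθ.integrable (Eventually.of_forall hθ.2.2.1),
    hθ.2.2.2, ENNReal.ofReal_one]

lemma IsMollifier.integral_mollifierMeasure (hθ : IsMollifier θ)
    (F : EuclideanSpace ℝ (Fin d) → ℝ) : ∫ x, F x ∂mollifierMeasure θ = ∫ x, θ x * F x := by
  rw [mollifierMeasure, integral_withDensity_eq_integral_toReal_smul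
    hθ.measurable.ennreal_ofReal (by simp)]
  simp [ENNReal.toReal_ofReal (hθ.2.2.1 _)]

lemma IsMollifier.integral_mollifierScaled_mul (hθ : IsMollifier θ) {ε : ℝ} (hε : 0 < ε)
    (F : EuclideanSpace ℝ (Fin d) → ℝ) :
    ∫ u, mollifierScaled θ ε u * F u = ∫ u, F (ε • u) ∂mollifierMeasure θ := by
  have h := Measure.integral_comp_inv_smul_of_nonneg volume
    (fun w : EuclideanSpace ℝ (Fin d) => θ w * F (ε • w)) hε.le
  simp only [smul_inv_smul₀ hε.ne', finrank_euclideanSpace_fin, smul_eq_mul] at h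
  rw [hθ.integral_mollifierMeasure]
  simp only [mollifierScaled, mul_assoc]
  rw [integral_const_mul, h, inv_mul_cancel_left₀ (pow_pos hε d).ne']

lemma mollifiedCov_eq_integral (hθ₁ : IsMollifier θ₁) (hθ₂ : IsMollifier θ₂) {ε ε' : ℝ}
    (hε : 0 < ε) (hε' : 0 < ε') (x y : EuclideanSpace ℝ (Fin d)) :
    mollifiedCov K θ₁ θ₂ ε ε' x y =
      ∫ u, ∫ v, K (x - ε • u) (y - ε' • v) ∂mollifierMeasure θ₂ ∂mollifierMeasure θ₁ := by
  simp only [mollifiedCov, mul_assoc, integral_const_mul]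
  rw [hθ₁.integral_mollifierScaled_mul hε]
  simp only [hθ₂.integral_mollifierScaled_mul hε']

lemma IsMollifier.exists_norm_le (hθ : IsMollifier θ) :
    ∃ R, ∀ᵐ u ∂mollifierMeasure θ, ‖u‖ ≤ R := by
  obtain ⟨R, hR⟩ := hθ.2.1.isCompact.isBounded.exists_norm_le
  refine ⟨R, ?_⟩
  rw [mollifierMeasure, ae_withDensity_iff hθ.measurable.ennreal_ofReal]
  refine Eventually.of_forall fun x hx => hR x (subset_tsupport _ ?_)
  rw [Function.mem_support]
  rintro h
  simp [h] at hx

lemma IsMollifier.exists_integral_posLog_le [NeZero d] (hθ : IsMollifier θ) :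
    ∃ B, ∀ a : EuclideanSpace ℝ (Fin d),
      Integrable (fun v => Real.posLog ‖a + v‖⁻¹) (mollifierMeasure θ) ∧
        ∫ v, Real.posLog ‖a + v‖⁻¹ ∂mollifierMeasure θ ≤ B := by
  obtain ⟨C, hC⟩ := hθ.2.1.exists_bound_of_continuous hθ.1.continuous
  have hL := integrable_posLog_norm_inv (volume : Measure (EuclideanSpace ℝ (Fin d)))
  refine ⟨C * ∫ v : EuclideanSpace ℝ (Fin d), Real.posLog ‖v‖⁻¹, fun a => ?_⟩
  have hLa := hL.comp_add_left a
  have hmul : Integrable (fun v => θ v * Real.posLog ‖a + v‖⁻¹) :=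
    hLa.bdd_mul hθ.measurable.aestronglyMeasurable (Eventually.of_forall hC)
  refine ⟨?_, ?_⟩
  · rw [mollifierMeasure, integrable_withDensity_iff_integrable_smul'
      hθ.measurable.ennreal_ofReal (by simp)]
    simpa [ENNReal.toReal_ofReal (hθ.2.2.1 _)] using hmul
  · rw [hθ.integral_mollifierMeasure,
      ← integral_add_left_eq_self (fun v => Real.posLog ‖v‖⁻¹) a, ← integral_const_mul]
    refine integral_mono hmul (hLa.const_mul C) fun v => ?_
    exact mul_le_mul_of_nonneg_right ((le_abs_self _).trans (hC v)) Real.posLog_nonneg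

lemma logKernel_eq_posLog (x y : EuclideanSpace ℝ (Fin d)) :
    logKernel g x y = Real.posLog ‖x - y‖⁻¹ + g x y := by
  rw [logKernel, dist_eq_norm, max_comm, Real.posLog_apply]

lemma measurable_logKernel (hg : IsBoundedMeasurable g) :
    Measurable (Function.uncurry (logKernel g)) := by
  have : Function.uncurry (logKernel g) = fun p : EuclideanSpace ℝ (Fin d) × _ =>
      Real.posLog ‖p.1 - p.2‖⁻¹ + Function.uncurry g p := by
    funext p
    exact logKernel_eq_posLog p.1 p.2
  rw [this]
  exact (measurable_posLog_norm_inv.comp (measurable_fst.sub measurable_snd)).add hg.1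

lemma continuousAt_logKernel (hg : Continuous (Function.uncurry g))
    {x y : EuclideanSpace ℝ (Fin d)} (hxy : x ≠ y) :
    ContinuousAt (Function.uncurry (logKernel g)) (x, y) := by
  have : Function.uncurry (logKernel g) = fun p : EuclideanSpace ℝ (Fin d) × _ =>
      Real.posLog ‖p.1 - p.2‖⁻¹ + Function.uncurry g p := by
    funext p
    exact logKernel_eq_posLog p.1 p.2
  rw [this]
  refine ContinuousAt.add ?_ hg.continuousAt
  refine Real.continuous_posLog.continuousAt.comp ?_
  refine ContinuousAt.inv₀ (by fun_prop) ?_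
  simpa [sub_eq_zero] using hxy

lemma measurable_mollifiedCov (hK : Measurable (Function.uncurry K)) (hθ₁ : IsMollifier θ₁)
    (hθ₂ : IsMollifier θ₂) {ε ε' : ℝ} (hε : 0 < ε) (hε' : 0 < ε') :
    Measurable (Function.uncurry (mollifiedCov K θ₁ θ₂ ε ε')) := by
  have := hθ₁.isProbabilityMeasure
  have := hθ₂.isProbabilityMeasure
  have h : Function.uncurry (mollifiedCov K θ₁ θ₂ ε ε') =
      fun p : EuclideanSpace ℝ (Fin d) × EuclideanSpace ℝ (Fin d) =>
      ∫ u, ∫ v, K (p.1 - ε • u) (p.2 - ε' • v) ∂mollifierMeasure θ₂ ∂mollifierMeasure θ₁ := by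
    funext p
    exact mollifiedCov_eq_integral hθ₁ hθ₂ hε hε' p.1 p.2
  rw [h]
  have hm : Measurable fun q : ((EuclideanSpace ℝ (Fin d) × EuclideanSpace ℝ (Fin d)) ×
      EuclideanSpace ℝ (Fin d)) × EuclideanSpace ℝ (Fin d) =>
      K (q.1.1.1 - ε • q.1.2) (q.1.1.2 - ε' • q.2) :=
    hK.comp (f := fun q : ((EuclideanSpace ℝ (Fin d) × EuclideanSpace ℝ (Fin d)) ×
      EuclideanSpace ℝ (Fin d)) × EuclideanSpace ℝ (Fin d) =>
        (q.1.1.1 - ε • q.1.2, q.1.1.2 - ε' • q.2)) (by fun_prop)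
  exact (hm.stronglyMeasurable.integral_prod_right' (ν := mollifierMeasure θ₂)
    |>.integral_prod_right' (ν := mollifierMeasure θ₁)).measurable

/-- Mollification preserves the logarithmic bound on the kernel, uniformly in the scale. -/
lemma exists_abs_mollifiedCov_logKernel_le [NeZero d] (hg : IsBoundedMeasurable g)
    (hθ₁ : IsMollifier θ₁) (hθ₂ : IsMollifier θ₂) :
    ∃ c, ∀ ε : ℝ, 0 < ε → ∀ x y, x ≠ y →
      |mollifiedCov (logKernel g) θ₁ θ₂ ε ε x y| ≤ Real.posLog ‖x - y‖⁻¹ + c := by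
  have := hθ₁.isProbabilityMeasure
  have := hθ₂.isProbabilityMeasure
  obtain ⟨Cg, hCg⟩ := hg.2
  obtain ⟨R₁, hR₁⟩ := hθ₁.exists_norm_le
  obtain ⟨R₂, hR₂⟩ := hθ₂.exists_norm_le
  obtain ⟨B, hB⟩ := hθ₂.exists_integral_posLog_le
  refine ⟨Real.log 2 + Real.posLog (R₁ + R₂) + Cg + B, fun ε hε x y hxy => ?_⟩
  rw [mollifiedCov_eq_integral hθ₁ hθ₂ hε hε, ← Real.norm_eq_abs]
  refine (norm_integral_le_of_norm_le_const (C := Real.posLog ‖x - y‖⁻¹ +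
    (Real.log 2 + Real.posLog (R₁ + R₂) + Cg + B)) ?_).trans_eq (by simp)
  filter_upwards [hR₁] with u hu
  obtain ⟨hi, hle⟩ := hB (ε⁻¹ • (x - y) - u)
  refine (norm_integral_le_of_norm_le (((integrable_const (Real.posLog ‖x - y‖⁻¹ +
    (Real.log 2 + Real.posLog (R₁ + R₂)) + Cg)).add hi)) ?_).trans ?_
  · filter_upwards [hR₂] with v hv
    have h := posLog_norm_inv_sub_smul_le hε (sub_ne_zero.2 hxy)
      ((norm_sub_le u v).trans (add_le_add hu hv))
    have h1 : x - ε • u - (y - ε • v) = x - y - ε • (u - v) := by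
      rw [smul_sub]; abel
    have h2 : ε⁻¹ • (x - y) - u + v = ε⁻¹ • (x - y) - (u - v) := by abel
    rw [logKernel_eq_posLog, h1, Pi.add_apply, h2]
    have h3 := norm_add_le (Real.posLog ‖x - y - ε • (u - v)‖⁻¹) (g (x - ε • u) (y - ε • v))
    rw [Real.norm_of_nonneg Real.posLog_nonneg, Real.norm_eq_abs (g _ _)] at h3
    linarith [hCg (x - ε • u) (y - ε • v)]
  · rw [integral_add' (integrable_const _) hi, integral_const, probReal_univ, one_smul]
    linarith

/-- The mollified kernel converges at continuity points. -/
lemma tendsto_mollifiedCov (hK : Measurable (Function.uncurry K)) (hθ₁ : IsMollifier θ₁)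
    (hθ₂ : IsMollifier θ₂) {x y : EuclideanSpace ℝ (Fin d)}
    (hxy : ContinuousAt (Function.uncurry K) (x, y)) :
    Tendsto (fun ε => mollifiedCov K θ₁ θ₂ ε ε x y) (𝓝[Set.Ioc (0 : ℝ) 1] 0) (𝓝 (K x y)) := by
  have := hθ₁.isProbabilityMeasure
  have := hθ₂.isProbabilityMeasure
  obtain ⟨R₁, hR₁⟩ := hθ₁.exists_norm_le
  obtain ⟨R₂, hR₂⟩ := hθ₂.exists_norm_le
  rw [Metric.tendsto_nhds]
  intro δ hδ
  obtain ⟨η, hη, hball⟩ := Metric.continuousAt_iff.1 hxy (δ / 2) (half_pos hδ)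
  have hsmall : ∀ R : ℝ, ∀ᶠ ε in 𝓝[Set.Ioc (0 : ℝ) 1] 0, ε * R < η := fun R =>
    (Continuous.tendsto' (by fun_prop) 0 0 (by simp) :
      Tendsto (fun ε : ℝ => ε * R) (𝓝 0) (𝓝 0)).mono_left nhdsWithin_le_nhds
      |>.eventually_lt_const hη
  filter_upwards [hsmall R₁, hsmall R₂, self_mem_nhdsWithin] with ε h₁ h₂ hε
  have hε0 : 0 < ε := hε.1
  rw [mollifiedCov_eq_integral hθ₁ hθ₂ hε0 hε0]
  have hclose : ∀ u v : EuclideanSpace ℝ (Fin d), ‖u‖ ≤ R₁ → ‖v‖ ≤ R₂ →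
      K (x - ε • u) (y - ε • v) ∈ Metric.closedBall (K x y) (δ / 2) := by
    intro u v hu hv
    refine Metric.mem_closedBall.2 (le_of_lt (hball (x := (x - ε • u, y - ε • v)) ?_))
    rw [Prod.dist_eq, max_lt_iff]
    simp only [dist_self_sub_left, norm_smul_of_nonneg hε0.le]
    exact ⟨(mul_le_mul_of_nonneg_left hu hε0.le).trans_lt h₁,
      (mul_le_mul_of_nonneg_left hv hε0.le).trans_lt h₂⟩
  have hm : Measurable fun q : EuclideanSpace ℝ (Fin d) × EuclideanSpace ℝ (Fin d) =>
      K (x - ε • q.1) (y - ε • q.2) :=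
    hK.comp (f := fun q : EuclideanSpace ℝ (Fin d) × EuclideanSpace ℝ (Fin d) =>
      (x - ε • q.1, y - ε • q.2)) (by fun_prop)
  have hbdd : ∀ {a : ℝ}, a ∈ Metric.closedBall (K x y) (δ / 2) → ‖a‖ ≤ |K x y| + δ / 2 := by
    intro a ha
    rw [Metric.mem_closedBall, dist_eq_norm] at ha
    have := norm_sub_norm_le a (K x y)
    rw [Real.norm_eq_abs (K x y)] at this
    linarith
  have hinner : ∀ᵐ u ∂mollifierMeasure θ₁,
      ∫ v, K (x - ε • u) (y - ε • v) ∂mollifierMeasure θ₂ ∈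
        Metric.closedBall (K x y) (δ / 2) := by
    filter_upwards [hR₁] with u hu
    have hae : ∀ᵐ v ∂mollifierMeasure θ₂,
        K (x - ε • u) (y - ε • v) ∈ Metric.closedBall (K x y) (δ / 2) := by
      filter_upwards [hR₂] with v hv using hclose u v hu hv
    refine (convex_closedBall _ _).integral_mem Metric.isClosed_closedBall hae ?_
    exact Integrable.of_bound (hm.comp (measurable_const.prodMk measurable_id)).aestronglyMeasurable
      (|K x y| + δ / 2) (hae.mono fun v hv => hbdd hv)
  refine (Metric.mem_closedBall.1 ((convex_closedBall _ _).integral_mem Metric.isClosed_closedBall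
    hinner ?_)).trans_lt (half_lt_self hδ)
  exact Integrable.of_bound
    (hm.stronglyMeasurable.integral_prod_right' (ν := mollifierMeasure θ₂)).aestronglyMeasurable
    (|K x y| + δ / 2) (hinner.mono fun v hv => hbdd hv)

end Mollification

section SecondMoment

/-- Fubini's theorem for the product moment of two integrated nonnegative random fields. -/
lemma integrable_and_integral_mul_integral {α Ω : Type*} [MeasurableSpace α] [MeasurableSpace Ω]
    {P : Measure Ω} [SFinite P] {μ : Measure α} [SFinite μ] {U V : α → Ω → ℝ}
    (hU : Measurable (Function.uncurry U)) (hV : Measurable (Function.uncurry V))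
    (hU0 : ∀ x ω, 0 ≤ U x ω) (hV0 : ∀ x ω, 0 ≤ V x ω) {S : α × α → ℝ}
    (hint : ∀ x y, Integrable (fun ω => U x ω * V y ω) P)
    (hS : ∀ x y, ∫ ω, U x ω * V y ω ∂P = S (x, y)) (hSint : Integrable S (μ.prod μ)) :
    Integrable (fun ω => (∫ x, U x ω ∂μ) * ∫ y, V y ω ∂μ) P ∧
      ∫ ω, (∫ x, U x ω ∂μ) * (∫ y, V y ω ∂μ) ∂P = ∫ p, S p ∂μ.prod μ := by
  have hm : Measurable fun q : (α × α) × Ω => U q.1.1 q.2 * V q.1.2 q.2 :=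
    (hU.comp (f := fun q : (α × α) × Ω => (q.1.1, q.2)) (by fun_prop)).mul
      (hV.comp (f := fun q : (α × α) × Ω => (q.1.2, q.2)) (by fun_prop))
  have hH : Integrable (fun q : (α × α) × Ω => U q.1.1 q.2 * V q.1.2 q.2)
      ((μ.prod μ).prod P) := by
    rw [integrable_prod_iff hm.aestronglyMeasurable]
    refine ⟨Eventually.of_forall fun p => hint p.1 p.2, hSint.congr ?_⟩
    refine Eventually.of_forall fun p => ?_
    simp only [Real.norm_of_nonneg (mul_nonneg (hU0 _ _) (hV0 _ _))]
    exact (hS p.1 p.2).symm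
  refine ⟨?_, ?_⟩
  · refine hH.integral_prod_right.congr (Eventually.of_forall fun ω => ?_)
    exact integral_prod_mul (fun x => U x ω) fun y => V y ω
  · calc _ = ∫ ω, ∫ p : α × α, U p.1 ω * V p.2 ω ∂μ.prod μ ∂P := by
          refine integral_congr_ae (Eventually.of_forall fun ω => ?_)
          exact (integral_prod_mul (fun x => U x ω) fun y => V y ω).symm
      _ = ∫ p : α × α, ∫ ω, U p.1 ω * V p.2 ω ∂P ∂μ.prod μ :=
          (integral_integral_swap (f := fun (p : α × α) ω => U p.1 ω * V p.2 ω) hH).symm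
      _ = _ := by simp only [hS]

lemma integrable_and_integral_exp_of_map_eq_gaussianReal {Ω : Type*} [MeasurableSpace Ω]
    {P : Measure Ω} {Y : Ω → ℝ} {v : ℝ≥0} (hY : P.map Y = gaussianReal 0 v) (t : ℝ) :
    Integrable (fun ω => Real.exp (t * Y ω)) P ∧
      ∫ ω, Real.exp (t * Y ω) ∂P = Real.exp (v * t ^ 2 / 2) := by
  have h : ∫ ω, Real.exp (t * Y ω) ∂P = Real.exp (v * t ^ 2 / 2) := by
    simpa [mgf] using mgf_gaussianReal hY t
  refine ⟨?_, h⟩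
  by_contra hn
  rw [integral_undef hn] at h
  exact (Real.exp_pos _).ne h

/-- Two functions with `L²` product moments all converging to the same limit are asymptotically
equal in mean square. -/
lemma tendsto_integral_sub_sq {ι Ω : Type*} [MeasurableSpace Ω] {P : Measure Ω} {l : Filter ι}
    {M : Bool → ι → Ω → ℝ} {J : ℝ}
    (hM : ∀ a b, (∀ᶠ i in l, Integrable (fun ω => M a i ω * M b i ω) P) ∧
      Tendsto (fun i => ∫ ω, M a i ω * M b i ω ∂P) l (𝓝 J)) :
    Tendsto (fun i => ∫ ω, (M false i ω - M true i ω) ^ 2 ∂P) l (𝓝 0) := by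
  have h := ((hM false false).2.sub ((hM false true).2.const_mul 2)).add (hM true true).2
  rw [show J - 2 * J + J = 0 by ring] at h
  refine h.congr' ?_
  filter_upwards [(hM false false).1, (hM false true).1, (hM true true).1] with i h₀ h₁ h₂
  rw [← integral_const_mul, ← integral_sub h₀ (h₁.const_mul 2),
    ← integral_add (f := fun ω => M false i ω * M false i ω - 2 * (M false i ω * M true i ω))
      (h₀.sub (h₁.const_mul 2)) h₂]
  refine integral_congr_ae (Eventually.of_forall fun ω => ?_)
  ring

/-- Convergence of the integrated two-point functions. -/
lemma integrable_and_tendsto_twoPoint [NeZero d]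
    {g : EuclideanSpace ℝ (Fin d) → EuclideanSpace ℝ (Fin d) → ℝ} (hg : IsBoundedMeasurable g)
    (hgcont : Continuous (Function.uncurry g)) {θ₁ θ₂ : EuclideanSpace ℝ (Fin d) → ℝ}
    (hθ₁ : IsMollifier θ₁) (hθ₂ : IsMollifier θ₂) {γ : ℝ} (hγ : γ ^ 2 < d)
    {f : EuclideanSpace ℝ (Fin d) → ℝ} (hf0 : ∀ x, 0 ≤ f x) (hfmeas : Measurable f)
    (hfbdd : ∃ C, ∀ x, f x ≤ C) {A : Set (EuclideanSpace ℝ (Fin d))} (hA : IsCompact A) :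
    (∀ ε : ℝ, 0 < ε → Integrable (fun p : EuclideanSpace ℝ (Fin d) × EuclideanSpace ℝ (Fin d) =>
        f p.1 * f p.2 * Real.exp (γ ^ 2 / 2 * (mollifiedCov (logKernel g) θ₁ θ₂ ε ε p.1 p.2 +
          mollifiedCov (logKernel g) θ₂ θ₁ ε ε p.2 p.1)))
        ((volume.restrict A).prod (volume.restrict A))) ∧
      Tendsto (fun ε => ∫ p : EuclideanSpace ℝ (Fin d) × EuclideanSpace ℝ (Fin d),
        f p.1 * f p.2 * Real.exp (γ ^ 2 / 2 * (mollifiedCov (logKernel g) θ₁ θ₂ ε ε p.1 p.2 +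
          mollifiedCov (logKernel g) θ₂ θ₁ ε ε p.2 p.1))
        ∂(volume.restrict A).prod (volume.restrict A)) (𝓝[Set.Ioc (0 : ℝ) 1] 0)
        (𝓝 (∫ p : EuclideanSpace ℝ (Fin d) × EuclideanSpace ℝ (Fin d),
          f p.1 * f p.2 * Real.exp (γ ^ 2 / 2 * (logKernel g p.1 p.2 + logKernel g p.2 p.1))
          ∂(volume.restrict A).prod (volume.restrict A))) := by
  obtain ⟨C, hC⟩ := hfbdd
  obtain ⟨c₁, hc₁⟩ := exists_abs_mollifiedCov_logKernel_le hg hθ₁ hθ₂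
  obtain ⟨c₂, hc₂⟩ := exists_abs_mollifiedCov_logKernel_le hg hθ₂ hθ₁
  have hK := measurable_logKernel hg
  have hne : ∀ᵐ p ∂(volume.restrict A).prod (volume.restrict A),
      (p : EuclideanSpace ℝ (Fin d) × EuclideanSpace ℝ (Fin d)).1 ≠ p.2 := by
    refine Measure.ae_prod_iff_ae_ae ?_ |>.2 (Eventually.of_forall fun x => ?_)
    · exact measurableSet_diagonal.compl
    · exact (Measure.ae_ne _ x).mono fun y hy => hy.symm
  have hbint := (integrable_exp_mul_posLog_norm_sub_inv
    (volume : Measure (EuclideanSpace ℝ (Fin d))) (s := γ ^ 2)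
    (by rwa [finrank_euclideanSpace_fin]) hA.isBounded hA.measurableSet).const_mul
      (C * C * Real.exp (γ ^ 2 / 2 * (c₁ + c₂)))
  have hmeas : ∀ ε : ℝ, 0 < ε → Measurable
      fun p : EuclideanSpace ℝ (Fin d) × EuclideanSpace ℝ (Fin d) =>
        f p.1 * f p.2 * Real.exp (γ ^ 2 / 2 * (mollifiedCov (logKernel g) θ₁ θ₂ ε ε p.1 p.2 +
          mollifiedCov (logKernel g) θ₂ θ₁ ε ε p.2 p.1)) := by
    intro ε hε
    have h₁ := measurable_mollifiedCov hK hθ₁ hθ₂ hε hε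
    have h₂ := (measurable_mollifiedCov hK hθ₂ hθ₁ hε hε).comp measurable_swap
    exact ((hfmeas.comp measurable_fst).mul (hfmeas.comp measurable_snd)).mul
      ((h₁.add h₂).const_mul _).exp
  have hbound : ∀ ε : ℝ, 0 < ε → ∀ᵐ p ∂(volume.restrict A).prod (volume.restrict A),
      ‖f p.1 * f p.2 * Real.exp (γ ^ 2 / 2 * (mollifiedCov (logKernel g) θ₁ θ₂ ε ε p.1 p.2 +
          mollifiedCov (logKernel g) θ₂ θ₁ ε ε p.2 p.1))‖ ≤
        C * C * Real.exp (γ ^ 2 / 2 * (c₁ + c₂)) *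
          Real.exp (γ ^ 2 * Real.posLog ‖p.1 - p.2‖⁻¹) := by
    intro ε hε
    filter_upwards [hne] with p hp
    have h₁ := (le_abs_self _).trans (hc₁ ε hε p.1 p.2 hp)
    have h₂ := (le_abs_self _).trans (hc₂ ε hε p.2 p.1 hp.symm)
    rw [norm_sub_rev] at h₂
    rw [Real.norm_of_nonneg (mul_nonneg (mul_nonneg (hf0 _) (hf0 _)) (Real.exp_pos _).le),
      mul_assoc (C * C), ← Real.exp_add]
    have hC0 : 0 ≤ C := (hf0 0).trans (hC 0)
    refine mul_le_mul (mul_le_mul (hC _) (hC _) (hf0 _) hC0) (Real.exp_le_exp.2 ?_)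
      (Real.exp_pos _).le (mul_nonneg hC0 hC0)
    calc _ ≤ γ ^ 2 / 2 * ((Real.posLog ‖p.1 - p.2‖⁻¹ + c₁) + (Real.posLog ‖p.1 - p.2‖⁻¹ + c₂)) := by
          gcongr
      _ = _ := by ring
  refine ⟨fun ε hε => hbint.mono' (hmeas ε hε).aestronglyMeasurable (hbound ε hε), ?_⟩
  refine tendsto_integral_filter_of_dominated_convergence _ ?_ ?_ hbint ?_
  · filter_upwards [self_mem_nhdsWithin] with ε hε using (hmeas ε hε.1).aestronglyMeasurable
  · filter_upwards [self_mem_nhdsWithin] with ε hε using hbound ε hε.1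
  · filter_upwards [hne] with p hp
    have h₁ := tendsto_mollifiedCov hK hθ₁ hθ₂ (continuousAt_logKernel hgcont hp)
    have h₂ := tendsto_mollifiedCov hK hθ₂ hθ₁ (continuousAt_logKernel hgcont hp.symm)
    exact (((h₁.add h₂).const_mul _).rexp).const_mul _

/-- Mean-square comparison of two approximate chaos measures whose underlying fields `Y false`
and `Y true` are mollifications of the same log-correlated field. -/
lemma tendsto_integral_approxGMC_sub_sq [NeZero d]
    {g : EuclideanSpace ℝ (Fin d) → EuclideanSpace ℝ (Fin d) → ℝ} (hg : IsBoundedMeasurable g)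
    (hgcont : Continuous (Function.uncurry g))
    {T : Bool → EuclideanSpace ℝ (Fin d) → ℝ} (hT : ∀ b, IsMollifier (T b))
    {Ω : Type*} [MeasurableSpace Ω] {P : Measure Ω} [IsProbabilityMeasure P]
    {Y : Bool → ℝ → EuclideanSpace ℝ (Fin d) → Ω → ℝ}
    (hmeas : Measurable fun p : Bool × ℝ × EuclideanSpace ℝ (Fin d) × Ω =>
      Y p.1 p.2.1 p.2.2.1 p.2.2.2)
    (hGauss : ∀ (n : ℕ) (s : Fin n → Bool) (ε : Fin n → ℝ)
      (x : Fin n → EuclideanSpace ℝ (Fin d)),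
      (∀ i, ε i ∈ Set.Ioc (0 : ℝ) 1) → ∀ l : Fin n → ℝ, ∃ v : ℝ≥0,
        (v : ℝ) = ∑ i, ∑ j, l i * l j *
          mollifiedCov (logKernel g) (T (s i)) (T (s j)) (ε i) (ε j) (x i) (x j) ∧
        Measure.map (fun ω => ∑ i, l i * Y (s i) (ε i) (x i) ω) P = gaussianReal 0 v)
    {γ : ℝ} (hγ0 : 0 < γ) (hγd : γ < Real.sqrt d)
    {f : EuclideanSpace ℝ (Fin d) → ℝ} (hf0 : ∀ x, 0 ≤ f x) (hfmeas : Measurable f)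
    (hfbdd : ∃ C, ∀ x, f x ≤ C) {A : Set (EuclideanSpace ℝ (Fin d))} (hA : IsCompact A) :
    Tendsto
      (fun ε => ∫ ω,
        (approxGMC γ (Y false) (mollifiedCov (logKernel g) (T false) (T false)) f ε ω A -
          approxGMC γ (Y true) (mollifiedCov (logKernel g) (T true) (T true)) f ε ω A) ^ 2 ∂P)
      (𝓝[Set.Ioc (0 : ℝ) 1] 0) (𝓝 0) := by
  have hγ : γ ^ 2 < d := (Real.lt_sqrt hγ0.le).1 hγd
  have hK := measurable_logKernel hg
  set U : Bool → ℝ → EuclideanSpace ℝ (Fin d) → Ω → ℝ := fun b ε x ω =>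
    Real.exp (γ * Y b ε x ω - γ ^ 2 / 2 * mollifiedCov (logKernel g)
      (T b) (T b) ε ε x x) * f x with hU
  have hU0 : ∀ b ε x ω, 0 ≤ U b ε x ω := fun b ε x ω =>
    mul_nonneg (Real.exp_pos _).le (hf0 x)
  have hUm : ∀ b ε, 0 < ε → Measurable (Function.uncurry (U b ε)) := by
    intro b ε hε
    have h₁ : Measurable fun q : EuclideanSpace ℝ (Fin d) × Ω =>
        Y b ε q.1 q.2 :=
      hmeas.comp (f := fun q : EuclideanSpace ℝ (Fin d) × Ω => (b, ε, q.1, q.2)) (by fun_prop)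
    have h₂ : Measurable fun q : EuclideanSpace ℝ (Fin d) × Ω => mollifiedCov (logKernel g)
        (T b) (T b) ε ε q.1 q.1 :=
      Measurable.comp (g := Function.uncurry (mollifiedCov (logKernel g)
        (T b) (T b) ε ε))
        (f := fun q : EuclideanSpace ℝ (Fin d) × Ω => (q.1, q.1))
        (measurable_mollifiedCov hK (hT b) (hT b) hε hε) (by fun_prop)
    exact ((h₁.const_mul γ).sub (h₂.const_mul _)).exp.mul (hfmeas.comp measurable_fst)
  have hmoment : ∀ a b, ∀ ε ∈ Set.Ioc (0 : ℝ) 1, ∀ x y,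
      Integrable (fun ω => U a ε x ω * U b ε y ω) P ∧
      ∫ ω, U a ε x ω * U b ε y ω ∂P = f x * f y * Real.exp (γ ^ 2 / 2 *
        (mollifiedCov (logKernel g) (T a) (T b) ε ε x y +
          mollifiedCov (logKernel g) (T b) (T a) ε ε y x)) := by
    intro a b ε hε x y
    obtain ⟨v, hv, hmap⟩ := hGauss 2 ![a, b] (fun _ => ε) ![x, y] (fun _ => hε) fun _ => 1
    simp only [Fin.sum_univ_two, Matrix.cons_val_zero, Matrix.cons_val_one, one_mul] at hv hmap
    obtain ⟨hi, hI⟩ := integrable_and_integral_exp_of_map_eq_gaussianReal hmap γ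
    have hprod : ∀ ω, U a ε x ω * U b ε y ω = f x * f y * Real.exp (-(γ ^ 2 / 2 *
        (mollifiedCov (logKernel g) (T a) (T a) ε ε x x +
          mollifiedCov (logKernel g) (T b) (T b) ε ε y y))) *
        Real.exp (γ * (Y a ε x ω + Y b ε y ω)) := by
      intro ω
      simp only [hU]
      rw [mul_assoc (f x * f y), ← Real.exp_add, mul_mul_mul_comm, ← Real.exp_add, mul_comm]
      congr 2
      ring
    simp only [hprod]
    refine ⟨hi.const_mul _, ?_⟩
    rw [integral_const_mul, hI, hv, mul_assoc, ← Real.exp_add]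
    congr 2
    ring
  refine tendsto_integral_sub_sq (M := fun b ε ω => ∫ x in A, U b ε x ω)
    (J := ∫ p : EuclideanSpace ℝ (Fin d) × EuclideanSpace ℝ (Fin d),
      f p.1 * f p.2 * Real.exp (γ ^ 2 / 2 * (logKernel g p.1 p.2 + logKernel g p.2 p.1))
      ∂(volume.restrict A).prod (volume.restrict A)) fun a b => ?_
  obtain ⟨hi, hlim⟩ :=
    integrable_and_tendsto_twoPoint hg hgcont (hT a) (hT b) hγ hf0 hfmeas hfbdd hA
  have hFubini : ∀ ε ∈ Set.Ioc (0 : ℝ) 1, _ := fun ε hε =>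
    integrable_and_integral_mul_integral (hUm a ε hε.1) (hUm b ε hε.1) (hU0 a ε) (hU0 b ε)
      (S := fun p : EuclideanSpace ℝ (Fin d) × EuclideanSpace ℝ (Fin d) =>
        f p.1 * f p.2 * Real.exp (γ ^ 2 / 2 *
        (mollifiedCov (logKernel g) (T a) (T b) ε ε p.1 p.2 +
          mollifiedCov (logKernel g) (T b) (T a) ε ε p.2 p.1)))
      (fun x y => (hmoment a b ε hε x y).1) (fun x y => (hmoment a b ε hε x y).2) (hi ε hε.1)
  refine ⟨?_, hlim.congr' ?_⟩
  · filter_upwards [self_mem_nhdsWithin] with ε hε using (hFubini ε hε).1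
  · filter_upwards [self_mem_nhdsWithin] with ε hε using (hFubini ε hε).2.symm

end SecondMoment

/-- **Independence of the mollifier.** Assume `g` continuous, and let `θ`, `θ̄` be two
nonnegative smooth mollifiers. Suppose `X` and `X̄` are jointly measurable families on a common
probability space whose combined finite-dimensional distributions are centered Gaussian, with
covariances and cross-covariances given by the corresponding mollifications of the same
log-correlated kernel `K`. Then for the associated approximate chaos measures (same
`γ ∈ (0,√d)`, same bounded measurable density `f ≥ 0`) and every compact `A`,
`E[(M_ε(A) - M̄_ε(A))²] → 0` as `ε → 0`. -/
theorem gmc_mollifier_independence (hd : 1 ≤ d)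
    (g : EuclideanSpace ℝ (Fin d) → EuclideanSpace ℝ (Fin d) → ℝ) (hg : IsBoundedMeasurable g)
    (hgcont : Continuous (Function.uncurry g))
    (θ θb : EuclideanSpace ℝ (Fin d) → ℝ) (hθ : IsMollifier θ) (hθb : IsMollifier θb)
    {Ω : Type*} [MeasurableSpace Ω] (P : Measure Ω) [IsProbabilityMeasure P]
    (X Xb : ℝ → EuclideanSpace ℝ (Fin d) → Ω → ℝ)
    (hmeas : Measurable fun p : Bool × ℝ × EuclideanSpace ℝ (Fin d) × Ω =>
      (if p.1 then Xb else X) p.2.1 p.2.2.1 p.2.2.2)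
    (hGauss : ∀ (n : ℕ) (s : Fin n → Bool) (ε : Fin n → ℝ)
      (x : Fin n → EuclideanSpace ℝ (Fin d)),
      (∀ i, ε i ∈ Set.Ioc (0 : ℝ) 1) → ∀ l : Fin n → ℝ, ∃ v : ℝ≥0,
        (v : ℝ) = ∑ i, ∑ j, l i * l j *
          mollifiedCov (logKernel g) (if s i then θb else θ) (if s j then θb else θ)
            (ε i) (ε j) (x i) (x j) ∧
        Measure.map (fun ω => ∑ i, l i * (if s i then Xb else X) (ε i) (x i) ω) P =
          gaussianReal 0 v)
    (γ : ℝ) (hγ0 : 0 < γ) (hγd : γ < Real.sqrt d)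
    (f : EuclideanSpace ℝ (Fin d) → ℝ) (hf0 : ∀ x, 0 ≤ f x) (hfmeas : Measurable f)
    (hfbdd : ∃ C, ∀ x, f x ≤ C)
    (A : Set (EuclideanSpace ℝ (Fin d))) (hA : IsCompact A) (hAmeas : MeasurableSet A) :
    Tendsto
      (fun ε => ∫ ω,
        (approxGMC γ X (mollifiedCov (logKernel g) θ θ) f ε ω A -
          approxGMC γ Xb (mollifiedCov (logKernel g) θb θb) f ε ω A) ^ 2 ∂P)
      (𝓝[Set.Ioc (0 : ℝ) 1] 0) (𝓝 0) := by
  have : NeZero d := ⟨by omega⟩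
  have hT : ∀ b : Bool, IsMollifier (if b then θb else θ) := fun b => by
    cases b
    · exact hθ
    · exact hθb
  exact tendsto_integral_approxGMC_sub_sq (T := fun b => if b then θb else θ)
    (Y := fun b => if b then Xb else X) hg hgcont hT hmeas hGauss hγ0 hγd hf0 hfmeas hfbdd hA

end
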